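/- Every local automorphism of the algebra W₂ is an automorphism. -/

import Mathlib

set_option maxSynthPendingDepth 3

/-- The 2-dimensional vector space `V₂ = F²`, with standard basis `v₁ = (1,0)`, `v₂ = (0,1)`. -/
abbrev V2 (F : Type*) [Field F] := Fin 2 → F

/-- The fixed vector `v₁` (the first standard basis vector of `V₂`). -/
noncomputable def v1 (F : Type*) [Field F] : V2 F := Pi.single 0 1

/-- `W(2)`: the space of all bilinear multiplications on `V₂`. -/
abbrev Wtwo (F : Type*) [Field F] := V2 F →ₗ[F] V2 F →ₗ[F] V2 F

variable {F : Type*} [Field F]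

/-- The Kantor product on `W(2)`:
`(A·B)(x,y) = A(v₁, B(x,y)) − B(A(v₁,x), y) − B(x, A(v₁,y))`. -/
noncomputable def wmul (A B : Wtwo F) : Wtwo F :=
  LinearMap.mk₂ F
    (fun x y => A (v1 F) (B x y) - B (A (v1 F) x) y - B x (A (v1 F) y))
    (fun x x' y => by simp only [map_add, LinearMap.add_apply]; abel)
    (fun c x y => by simp only [map_smul, LinearMap.smul_apply, smul_sub])
    (fun x y y' => by simp only [map_add, LinearMap.add_apply]; abel)
    (fun c x y => by simp only [map_smul, LinearMap.smul_apply, smul_sub])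

/-- The multiplication `α^k_{i,j}` determined by `α^k_{i,j}(v_t, v_l) = δ_{it} δ_{jl} v_k`
(indices `0, 1` correspond to `1, 2` in the paper). -/
noncomputable def alph (k i j : Fin 2) : Wtwo F :=
  LinearMap.mk₂ F
    (fun x y => (x i * y j) • (Pi.single k 1 : V2 F))
    (fun x x' y => by simp [add_mul, add_smul])
    (fun c x y => by simp [smul_smul, mul_assoc])
    (fun x y y' => by simp [mul_add, add_smul])
    (fun c x y => by simp [smul_smul]; ring_nf)

noncomputable def e1 (F : Type*) [Field F] : Wtwo F := alph 0 0 0 - alph 1 0 1 - alph 1 1 0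

noncomputable def e2 (F : Type*) [Field F] : Wtwo F := alph 1 0 0

noncomputable def e3 (F : Type*) [Field F] : Wtwo F := alph 1 1 1 - alph 0 0 1 - alph 0 1 0

noncomputable def e4 (F : Type*) [Field F] : Wtwo F := alph 0 1 1

noncomputable def e5 (F : Type*) [Field F] : Wtwo F := (2 : F) • alph 0 0 0 + alph 1 0 1 + alph 1 1 0

noncomputable def e6 (F : Type*) [Field F] : Wtwo F := (2 : F) • alph 1 1 1 + alph 0 0 1 + alph 0 1 0


theorem wmul_add_left (A A' B : Wtwo F) : wmul (A + A') B = wmul A B + wmul A' B := by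
  apply LinearMap.ext; intro x; apply LinearMap.ext; intro y
  simp [wmul]; abel

theorem wmul_smul_left (c : F) (A B : Wtwo F) : wmul (c • A) B = c • wmul A B := by
  apply LinearMap.ext; intro x; apply LinearMap.ext; intro y
  simp [wmul, smul_sub]

theorem wmul_add_right (A B B' : Wtwo F) : wmul A (B + B') = wmul A B + wmul A B' := by
  apply LinearMap.ext; intro x; apply LinearMap.ext; intro y
  simp [wmul]; abel

theorem wmul_smul_right (c : F) (A B : Wtwo F) : wmul A (c • B) = c • wmul A B := by
  apply LinearMap.ext; intro x; apply LinearMap.ext; intro y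
  simp [wmul, smul_sub]

theorem wmul_sub_left (A A' B : Wtwo F) : wmul (A - A') B = wmul A B - wmul A' B := by
  apply LinearMap.ext; intro x; apply LinearMap.ext; intro y
  simp [wmul]; abel

theorem wmul_sub_right (A B B' : Wtwo F) : wmul A (B - B') = wmul A B - wmul A B' := by
  apply LinearMap.ext; intro x; apply LinearMap.ext; intro y
  simp [wmul]; abel

theorem wmul_alph (k i j k' i' j' : Fin 2) :
    wmul (alph k i j) (alph k' i' j' : Wtwo F) =
      (if i = 0 then (1:F) else 0) •
        ((if j = k' then (1:F) else 0) • alph k i' j'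
          - (if k = i' then (1:F) else 0) • alph k' j j'
          - (if k = j' then (1:F) else 0) • alph k' i' j) := by
  apply LinearMap.ext; intro x; apply LinearMap.ext; intro y
  funext m
  simp [wmul, alph, v1, Pi.single_apply]
  split_ifs <;> simp_all <;> try ring

theorem mul_e4_left (B : Wtwo F) : wmul (e4 F) B = 0 := by
  apply LinearMap.ext; intro x; apply LinearMap.ext; intro y
  simp [wmul, e4, alph, v1, Pi.single_apply]

theorem wmul_left_eq (A A' B : Wtwo F) (h : A (v1 F) = A' (v1 F)) : wmul A B = wmul A' B := by
  apply LinearMap.ext; intro x; apply LinearMap.ext; intro y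
  simp [wmul, h]

theorem red_e1 (B : Wtwo F) :
    wmul (e1 F) B = wmul (alph 0 0 0) B - wmul (alph 1 0 1) B := by
  rw [wmul_left_eq (e1 F) (alph 0 0 0 - alph 1 0 1) B, wmul_sub_left]
  apply LinearMap.ext; intro z; funext m
  fin_cases m <;> simp [e1, alph, v1, Pi.single_apply]

theorem red_e3 (B : Wtwo F) : wmul (e3 F) B = -wmul (alph 0 0 1) B := by
  have h : wmul (e3 F) B = wmul ((-1 : F) • alph 0 0 1) B := by
    apply wmul_left_eq
    apply LinearMap.ext; intro z; funext m
    fin_cases m <;> simp [e3, alph, v1, Pi.single_apply]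
  rw [h, wmul_smul_left]; module

theorem red_e5 (B : Wtwo F) :
    wmul (e5 F) B = (2 : F) • wmul (alph 0 0 0) B + wmul (alph 1 0 1) B := by
  rw [wmul_left_eq (e5 F) ((2 : F) • alph 0 0 0 + alph 1 0 1) B, wmul_add_left, wmul_smul_left]
  apply LinearMap.ext; intro z; funext m
  fin_cases m <;> simp [e5, alph, v1, Pi.single_apply]

theorem red_e6 (B : Wtwo F) : wmul (e6 F) B = wmul (alph 0 0 1) B := by
  apply wmul_left_eq
  apply LinearMap.ext; intro z; funext m
  fin_cases m <;> simp [e6, alph, v1, Pi.single_apply]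

theorem mul_L00_e1 : wmul (alph 0 0 0) (e1 F) = ((-1 : F)) • e1 F := by
  simp only [e1, e2, e3, e4, e5, e6, wmul_sub_right, wmul_add_right, wmul_smul_right, wmul_alph,
    Fin.reduceEq, reduceIte, one_smul, zero_smul, smul_zero, sub_zero, zero_sub,
    smul_sub, smul_add, smul_smul, neg_neg, smul_neg, neg_zero, sub_self, add_zero, zero_add]
  try module

theorem mul_L00_e2 : wmul (alph 0 0 0) (e2 F) = ((-2 : F)) • e2 F := by
  simp only [e1, e2, e3, e4, e5, e6, wmul_sub_right, wmul_add_right, wmul_smul_right, wmul_alph,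
    Fin.reduceEq, reduceIte, one_smul, zero_smul, smul_zero, sub_zero, zero_sub,
    smul_sub, smul_add, smul_smul, neg_neg, smul_neg, neg_zero, sub_self, add_zero, zero_add]
  try module

theorem mul_L00_e3 : wmul (alph 0 0 0) (e3 F) = 0 := by
  simp only [e1, e2, e3, e4, e5, e6, wmul_sub_right, wmul_add_right, wmul_smul_right, wmul_alph,
    Fin.reduceEq, reduceIte, one_smul, zero_smul, smul_zero, sub_zero, zero_sub,
    smul_sub, smul_add, smul_smul, neg_neg, smul_neg, neg_zero, sub_self, add_zero, zero_add]
  try module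

theorem mul_L00_e4 : wmul (alph 0 0 0) (e4 F) = ((1 : F)) • e4 F := by
  simp only [e1, e2, e3, e4, e5, e6, wmul_sub_right, wmul_add_right, wmul_smul_right, wmul_alph,
    Fin.reduceEq, reduceIte, one_smul, zero_smul, smul_zero, sub_zero, zero_sub,
    smul_sub, smul_add, smul_smul, neg_neg, smul_neg, neg_zero, sub_self, add_zero, zero_add]
  try module

theorem mul_L00_e5 : wmul (alph 0 0 0) (e5 F) = ((-1 : F)) • e5 F := by
  simp only [e1, e2, e3, e4, e5, e6, wmul_sub_right, wmul_add_right, wmul_smul_right, wmul_alph,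
    Fin.reduceEq, reduceIte, one_smul, zero_smul, smul_zero, sub_zero, zero_sub,
    smul_sub, smul_add, smul_smul, neg_neg, smul_neg, neg_zero, sub_self, add_zero, zero_add]
  try module

theorem mul_L00_e6 : wmul (alph 0 0 0) (e6 F) = 0 := by
  simp only [e1, e2, e3, e4, e5, e6, wmul_sub_right, wmul_add_right, wmul_smul_right, wmul_alph,
    Fin.reduceEq, reduceIte, one_smul, zero_smul, smul_zero, sub_zero, zero_sub,
    smul_sub, smul_add, smul_smul, neg_neg, smul_neg, neg_zero, sub_self, add_zero, zero_add]
  try module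

theorem mul_L01_e1 : wmul (alph 0 0 1) (e1 F) = ((2 : F)) • e3 F := by
  simp only [e1, e2, e3, e4, e5, e6, wmul_sub_right, wmul_add_right, wmul_smul_right, wmul_alph,
    Fin.reduceEq, reduceIte, one_smul, zero_smul, smul_zero, sub_zero, zero_sub,
    smul_sub, smul_add, smul_smul, neg_neg, smul_neg, neg_zero, sub_self, add_zero, zero_add]
  try module

theorem mul_L01_e2 : wmul (alph 0 0 1) (e2 F) = ((1 : F)) • e1 F := by
  simp only [e1, e2, e3, e4, e5, e6, wmul_sub_right, wmul_add_right, wmul_smul_right, wmul_alph,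
    Fin.reduceEq, reduceIte, one_smul, zero_smul, smul_zero, sub_zero, zero_sub,
    smul_sub, smul_add, smul_smul, neg_neg, smul_neg, neg_zero, sub_self, add_zero, zero_add]
  try module

theorem mul_L01_e3 : wmul (alph 0 0 1) (e3 F) = ((3 : F)) • e4 F := by
  simp only [e1, e2, e3, e4, e5, e6, wmul_sub_right, wmul_add_right, wmul_smul_right, wmul_alph,
    Fin.reduceEq, reduceIte, one_smul, zero_smul, smul_zero, sub_zero, zero_sub,
    smul_sub, smul_add, smul_smul, neg_neg, smul_neg, neg_zero, sub_self, add_zero, zero_add]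
  try module

theorem mul_L01_e4 : wmul (alph 0 0 1) (e4 F) = 0 := by
  simp only [e1, e2, e3, e4, e5, e6, wmul_sub_right, wmul_add_right, wmul_smul_right, wmul_alph,
    Fin.reduceEq, reduceIte, one_smul, zero_smul, smul_zero, sub_zero, zero_sub,
    smul_sub, smul_add, smul_smul, neg_neg, smul_neg, neg_zero, sub_self, add_zero, zero_add]
  try module

theorem mul_L01_e5 : wmul (alph 0 0 1) (e5 F) = ((-1 : F)) • e6 F := by
  simp only [e1, e2, e3, e4, e5, e6, wmul_sub_right, wmul_add_right, wmul_smul_right, wmul_alph,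
    Fin.reduceEq, reduceIte, one_smul, zero_smul, smul_zero, sub_zero, zero_sub,
    smul_sub, smul_add, smul_smul, neg_neg, smul_neg, neg_zero, sub_self, add_zero, zero_add]
  try module

theorem mul_L01_e6 : wmul (alph 0 0 1) (e6 F) = 0 := by
  simp only [e1, e2, e3, e4, e5, e6, wmul_sub_right, wmul_add_right, wmul_smul_right, wmul_alph,
    Fin.reduceEq, reduceIte, one_smul, zero_smul, smul_zero, sub_zero, zero_sub,
    smul_sub, smul_add, smul_smul, neg_neg, smul_neg, neg_zero, sub_self, add_zero, zero_add]
  try module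

theorem mul_L10_e1 : wmul (e2 F) (e1 F) = ((3 : F)) • e2 F := by
  simp only [e1, e2, e3, e4, e5, e6, wmul_sub_right, wmul_add_right, wmul_smul_right, wmul_alph,
    Fin.reduceEq, reduceIte, one_smul, zero_smul, smul_zero, sub_zero, zero_sub,
    smul_sub, smul_add, smul_smul, neg_neg, smul_neg, neg_zero, sub_self, add_zero, zero_add]
  try module

theorem mul_L10_e2 : wmul (e2 F) (e2 F) = 0 := by
  simp only [e1, e2, e3, e4, e5, e6, wmul_sub_right, wmul_add_right, wmul_smul_right, wmul_alph,
    Fin.reduceEq, reduceIte, one_smul, zero_smul, smul_zero, sub_zero, zero_sub,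
    smul_sub, smul_add, smul_smul, neg_neg, smul_neg, neg_zero, sub_self, add_zero, zero_add]
  try module

theorem mul_L10_e3 : wmul (e2 F) (e3 F) = ((2 : F)) • e1 F := by
  simp only [e1, e2, e3, e4, e5, e6, wmul_sub_right, wmul_add_right, wmul_smul_right, wmul_alph,
    Fin.reduceEq, reduceIte, one_smul, zero_smul, smul_zero, sub_zero, zero_sub,
    smul_sub, smul_add, smul_smul, neg_neg, smul_neg, neg_zero, sub_self, add_zero, zero_add]
  try module

theorem mul_L10_e4 : wmul (e2 F) (e4 F) = ((1 : F)) • e3 F := by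
  simp only [e1, e2, e3, e4, e5, e6, wmul_sub_right, wmul_add_right, wmul_smul_right, wmul_alph,
    Fin.reduceEq, reduceIte, one_smul, zero_smul, smul_zero, sub_zero, zero_sub,
    smul_sub, smul_add, smul_smul, neg_neg, smul_neg, neg_zero, sub_self, add_zero, zero_add]
  try module

theorem mul_L10_e5 : wmul (e2 F) (e5 F) = 0 := by
  simp only [e1, e2, e3, e4, e5, e6, wmul_sub_right, wmul_add_right, wmul_smul_right, wmul_alph,
    Fin.reduceEq, reduceIte, one_smul, zero_smul, smul_zero, sub_zero, zero_sub,
    smul_sub, smul_add, smul_smul, neg_neg, smul_neg, neg_zero, sub_self, add_zero, zero_add]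
  try module

theorem mul_L10_e6 : wmul (e2 F) (e6 F) = ((-1 : F)) • e5 F := by
  simp only [e1, e2, e3, e4, e5, e6, wmul_sub_right, wmul_add_right, wmul_smul_right, wmul_alph,
    Fin.reduceEq, reduceIte, one_smul, zero_smul, smul_zero, sub_zero, zero_sub,
    smul_sub, smul_add, smul_smul, neg_neg, smul_neg, neg_zero, sub_self, add_zero, zero_add]
  try module

theorem mul_L11_e1 : wmul (alph 1 0 1) (e1 F) = 0 := by
  simp only [e1, e2, e3, e4, e5, e6, wmul_sub_right, wmul_add_right, wmul_smul_right, wmul_alph,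
    Fin.reduceEq, reduceIte, one_smul, zero_smul, smul_zero, sub_zero, zero_sub,
    smul_sub, smul_add, smul_smul, neg_neg, smul_neg, neg_zero, sub_self, add_zero, zero_add]
  try module

theorem mul_L11_e2 : wmul (alph 1 0 1) (e2 F) = ((1 : F)) • e2 F := by
  simp only [e1, e2, e3, e4, e5, e6, wmul_sub_right, wmul_add_right, wmul_smul_right, wmul_alph,
    Fin.reduceEq, reduceIte, one_smul, zero_smul, smul_zero, sub_zero, zero_sub,
    smul_sub, smul_add, smul_smul, neg_neg, smul_neg, neg_zero, sub_self, add_zero, zero_add]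
  try module

theorem mul_L11_e3 : wmul (alph 1 0 1) (e3 F) = ((-1 : F)) • e3 F := by
  simp only [e1, e2, e3, e4, e5, e6, wmul_sub_right, wmul_add_right, wmul_smul_right, wmul_alph,
    Fin.reduceEq, reduceIte, one_smul, zero_smul, smul_zero, sub_zero, zero_sub,
    smul_sub, smul_add, smul_smul, neg_neg, smul_neg, neg_zero, sub_self, add_zero, zero_add]
  try module

theorem mul_L11_e4 : wmul (alph 1 0 1) (e4 F) = ((-2 : F)) • e4 F := by
  simp only [e1, e2, e3, e4, e5, e6, wmul_sub_right, wmul_add_right, wmul_smul_right, wmul_alph,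
    Fin.reduceEq, reduceIte, one_smul, zero_smul, smul_zero, sub_zero, zero_sub,
    smul_sub, smul_add, smul_smul, neg_neg, smul_neg, neg_zero, sub_self, add_zero, zero_add]
  try module

theorem mul_L11_e5 : wmul (alph 1 0 1) (e5 F) = 0 := by
  simp only [e1, e2, e3, e4, e5, e6, wmul_sub_right, wmul_add_right, wmul_smul_right, wmul_alph,
    Fin.reduceEq, reduceIte, one_smul, zero_smul, smul_zero, sub_zero, zero_sub,
    smul_sub, smul_add, smul_smul, neg_neg, smul_neg, neg_zero, sub_self, add_zero, zero_add]
  try module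

theorem mul_L11_e6 : wmul (alph 1 0 1) (e6 F) = ((-1 : F)) • e6 F := by
  simp only [e1, e2, e3, e4, e5, e6, wmul_sub_right, wmul_add_right, wmul_smul_right, wmul_alph,
    Fin.reduceEq, reduceIte, one_smul, zero_smul, smul_zero, sub_zero, zero_sub,
    smul_sub, smul_add, smul_smul, neg_neg, smul_neg, neg_zero, sub_self, add_zero, zero_add]
  try module

/-- `W2` as a subspace of `W(2)`. -/
noncomputable def W2 (F : Type*) [Field F] : Submodule F (Wtwo F) :=
  Submodule.span F {e1 F, e2 F, e3 F, e4 F, e5 F, e6 F}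

/-- The Kantor product, as a bilinear map. -/
noncomputable def wmulL (F : Type*) [Field F] : Wtwo F →ₗ[F] Wtwo F →ₗ[F] Wtwo F :=
  LinearMap.mk₂ F wmul wmul_add_left wmul_smul_left wmul_add_right wmul_smul_right

set_option maxHeartbeats 2000000 in
theorem W2_mul_mem {x y : Wtwo F} (hx : x ∈ W2 F) (hy : y ∈ W2 F) :
    wmul x y ∈ W2 F := by
  have h2 : Submodule.map₂ (wmulL F) (W2 F) (W2 F) ≤ W2 F := by
    rw [W2, Submodule.map₂_span_span, Submodule.span_le]
    rintro z ⟨a, ha, b, hb, rfl⟩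
    simp only [Set.mem_insert_iff, Set.mem_singleton_iff] at ha hb
    have m1 : e1 F ∈ W2 F := Submodule.subset_span (by simp)
    have m2 : e2 F ∈ W2 F := Submodule.subset_span (by simp)
    have m3 : e3 F ∈ W2 F := Submodule.subset_span (by simp)
    have m4 : e4 F ∈ W2 F := Submodule.subset_span (by simp)
    have m5 : e5 F ∈ W2 F := Submodule.subset_span (by simp)
    have m6 : e6 F ∈ W2 F := Submodule.subset_span (by simp)
    rcases ha with rfl | rfl | rfl | rfl | rfl | rfl <;> rcases hb with rfl | rfl | rfl | rfl | rfl | rfl <;>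
      simp only [wmulL, LinearMap.mk₂_apply, red_e1, red_e3, red_e5, red_e6, mul_L00_e1, mul_L00_e2, mul_L00_e3, mul_L00_e4, mul_L00_e5, mul_L00_e6, mul_L01_e1, mul_L01_e2, mul_L01_e3, mul_L01_e4, mul_L01_e5, mul_L01_e6, mul_L10_e1, mul_L10_e2, mul_L10_e3, mul_L10_e4, mul_L10_e5, mul_L10_e6, mul_L11_e1, mul_L11_e2, mul_L11_e3, mul_L11_e4, mul_L11_e5, mul_L11_e6, mul_e4_left,
        smul_smul, smul_zero, neg_zero, sub_zero, zero_sub, zero_add, add_zero, smul_neg,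
        neg_neg, sub_self] <;>
      (repeat' first
        | exact Submodule.zero_mem _
        | exact m1 | exact m2 | exact m3 | exact m4 | exact m5 | exact m6
        | apply Submodule.neg_mem
        | apply Submodule.sub_mem
        | apply Submodule.add_mem
        | apply Submodule.smul_mem)
  exact h2 (Submodule.apply_mem_map₂ _ hx hy)

/-- The product on `W2` (the Kantor product, which leaves `W2` invariant). -/
noncomputable def W2mul (x y : W2 F) : W2 F :=
  ⟨wmul x y, W2_mul_mem x.2 y.2⟩

/-- An automorphism of the algebra `W2`. -/
def IsAutomorphismW2 (φ : W2 F →ₗ[F] W2 F) : Prop :=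
  Function.Bijective φ ∧ ∀ x y : W2 F, φ (W2mul x y) = W2mul (φ x) (φ y)

/-- The element of `W2` with the given coordinates in the basis `e₁, …, e₆`. -/
noncomputable def ofCoords (a b c d e f : F) : W2 F :=
  ⟨a • e1 F + b • e2 F + c • e3 F + d • e4 F + e • e5 F + f • e6 F, by
    have h : ∀ z ∈ ({e1 F, e2 F, e3 F, e4 F, e5 F, e6 F} : Set (Wtwo F)), z ∈ W2 F :=
      fun z hz => Submodule.subset_span hz
    refine add_mem (add_mem (add_mem (add_mem (add_mem ?_ ?_) ?_) ?_) ?_) ?_ <;>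
      exact Submodule.smul_mem _ _ (h _ (by simp))⟩

theorem ofCoords_add (a b c d e f a' b' c' d' e' f' : F) :
    ofCoords a b c d e f + ofCoords a' b' c' d' e' f' =
      ofCoords (a + a') (b + b') (c + c') (d + d') (e + e') (f + f') := by
  apply Subtype.ext
  simp only [ofCoords, Submodule.coe_add]
  module

theorem smul_ofCoords (r a b c d e f : F) :
    r • ofCoords a b c d e f = ofCoords (r * a) (r * b) (r * c) (r * d) (r * e) (r * f) := by
  apply Subtype.ext
  simp only [ofCoords, Submodule.coe_smul]
  module

theorem exists_eq_ofCoords (x : W2 F) : ∃ a b c d e f : F, x = ofCoords a b c d e f := by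
  obtain ⟨x, hx⟩ := x
  have hx' := hx
  simp only [W2, Submodule.mem_span_insert, Submodule.mem_span_singleton] at hx'
  obtain ⟨a, _, ⟨b, _, ⟨c, _, ⟨d, _, ⟨e, _, ⟨f, rfl⟩, rfl⟩, rfl⟩, rfl⟩, rfl⟩, rfl⟩ :=
    hx'
  refine ⟨a, b, c, d, e, f, Subtype.ext ?_⟩
  simp only [ofCoords]
  module

theorem ofCoords_inj [CharZero F] {a b c d e f a' b' c' d' e' f' : F} :
    ofCoords a b c d e f = ofCoords a' b' c' d' e' f' ↔
      a = a' ∧ b = b' ∧ c = c' ∧ d = d' ∧ e = e' ∧ f = f' := by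
  refine ⟨fun h => ?_, by rintro ⟨rfl, rfl, rfl, rfl, rfl, rfl⟩; rfl⟩
  have key (i j k : Fin 2) := congrArg
    (fun A : W2 F => (A : Wtwo F) (Pi.single i 1) (Pi.single j 1) k) h
  have h0 := key 0 0 0
  have h1 := key 0 0 1
  have h2 := key 0 1 0
  have h3 := key 0 1 1
  have h4 := key 1 1 0
  have h5 := key 1 1 1
  simp [ofCoords, e1, e2, e3, e4, e5, e6, alph] at h0 h1 h2 h3 h4 h5
  have h3' : (3 : F) ≠ 0 := by norm_num
  refine ⟨?_, h1, ?_, h4, ?_, ?_⟩ <;> apply mul_left_cancel₀ h3'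
  · linear_combination h0 - 2 * h3
  · linear_combination h5 - 2 * h2
  · linear_combination h0 + h3
  · linear_combination h5 + h2

theorem W2mul_ofCoords (a b c d e f a' b' c' d' e' f' : F) :
    W2mul (ofCoords a b c d e f) (ofCoords a' b' c' d' e' f') =
      ofCoords
        (-(a + 2 * e) * a' + (f - c) * b' + 2 * b * c')
        (-2 * (a + 2 * e) * b' + (e - a) * b' + 3 * b * a')
        (-(e - a) * c' + 2 * (f - c) * a' + b * d')
        ((a + 2 * e) * d' - 2 * (e - a) * d' + 3 * (f - c) * c')
        (-(a + 2 * e) * e' - b * f')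
        (-(e - a) * f' - (f - c) * e') := by
  apply Subtype.ext
  simp only [W2mul, ofCoords, wmul_add_left, wmul_add_right, wmul_smul_left, wmul_smul_right,
    red_e1, red_e3, red_e5, red_e6, mul_L00_e1, mul_L00_e2, mul_L00_e3, mul_L00_e4, mul_L00_e5,
    mul_L00_e6, mul_L01_e1, mul_L01_e2, mul_L01_e3, mul_L01_e4, mul_L01_e5, mul_L01_e6,
    mul_L10_e1, mul_L10_e2, mul_L10_e3, mul_L10_e4, mul_L10_e5, mul_L10_e6, mul_L11_e1,
    mul_L11_e2, mul_L11_e3, mul_L11_e4, mul_L11_e5, mul_L11_e6, mul_e4_left]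
  module

theorem map_ofCoords (T : W2 F →ₗ[F] W2 F) (a b c d e f : F) :
    T (ofCoords a b c d e f) = a • T (ofCoords 1 0 0 0 0 0) + b • T (ofCoords 0 1 0 0 0 0) +
      c • T (ofCoords 0 0 1 0 0 0) + d • T (ofCoords 0 0 0 1 0 0) +
      e • T (ofCoords 0 0 0 0 1 0) + f • T (ofCoords 0 0 0 0 0 1) := by
  simp only [← map_smul, ← map_add, smul_ofCoords, ofCoords_add]
  simp

theorem ofCoords_zero : ofCoords (0 : F) 0 0 0 0 0 = 0 := by
  apply Subtype.ext
  simp [ofCoords]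

theorem mul_ofCoords_eq_zero_iff [CharZero F] {a b c d e f : F} :
    (∀ y, W2mul (ofCoords a b c d e f) y = 0) ↔ a = 0 ∧ b = 0 ∧ e = 0 ∧ c = f := by
  constructor
  · intro h
    have h4 := h (ofCoords 0 0 0 1 0 0)
    have h5 := h (ofCoords 0 0 0 0 1 0)
    have h6 := h (ofCoords 0 0 0 0 0 1)
    simp only [W2mul_ofCoords, ← ofCoords_zero, ofCoords_inj] at h4 h5 h6
    obtain ⟨-, -, h43, -⟩ := h4
    obtain ⟨-, -, -, -, h55, h56⟩ := h5
    obtain ⟨-, -, -, -, -, h66⟩ := h6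
    have h3 : (3 : F) ≠ 0 := by norm_num
    refine ⟨mul_left_cancel₀ h3 ?_, ?_, mul_left_cancel₀ h3 ?_, ?_⟩
    · linear_combination -h55 + 2 * h66
    · linear_combination h43
    · linear_combination -h55 - h66
    · linear_combination h56
  · rintro ⟨rfl, rfl, rfl, rfl⟩ y
    obtain ⟨a', b', c', d', e', f', rfl⟩ := exists_eq_ofCoords y
    simp [W2mul_ofCoords, ofCoords_zero]

namespace IsAutomorphismW2

variable {φ : W2 F →ₗ[F] W2 F}

theorem map_ne_zero (h : IsAutomorphismW2 φ) {x : W2 F} (hx : x ≠ 0) : φ x ≠ 0 :=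
  fun h0 => hx (h.1.1 (h0.trans φ.map_zero.symm))

/-- An automorphism preserves the left annihilator of `W2`, spanned by `e₄` and `e₃ + e₆`. -/
theorem mul_map_eq_zero [CharZero F] (h : IsAutomorphismW2 φ) (c d : F) (y : W2 F) :
    W2mul (φ (ofCoords 0 0 c d 0 c)) y = 0 := by
  obtain ⟨z, rfl⟩ := h.1.2 y
  rw [← h.2, mul_ofCoords_eq_zero_iff.2 (by simp), map_zero]

/-- An automorphism preserves the line spanned by `e₄`. -/
theorem map_e4 [CharZero F] (h : IsAutomorphismW2 φ) :
    ∃ d, d ≠ 0 ∧ φ (ofCoords 0 0 0 1 0 0) = ofCoords 0 0 0 d 0 0 := by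
  have h54 : W2mul (φ (ofCoords 0 0 0 0 1 0)) (φ (ofCoords 0 0 0 1 0 0)) = 0 := by
    rw [← h.2, W2mul_ofCoords]
    simp [ofCoords_zero]
  have h64 : W2mul (φ (ofCoords 0 0 0 0 0 1)) (φ (ofCoords 0 0 0 1 0 0)) = 0 := by
    rw [← h.2, W2mul_ofCoords]
    simp [ofCoords_zero]
  have h55 : W2mul (φ (ofCoords 0 0 0 0 1 0)) (φ (ofCoords 0 0 0 0 1 0)) =
      (-2 : F) • φ (ofCoords 0 0 0 0 1 0) := by
    rw [← h.2, ← map_smul, W2mul_ofCoords, smul_ofCoords]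
    norm_num
  have h56 : W2mul (φ (ofCoords 0 0 0 0 1 0)) (φ (ofCoords 0 0 0 0 0 1)) =
      (-1 : F) • φ (ofCoords 0 0 0 0 0 1) := by
    rw [← h.2, ← map_smul, W2mul_ofCoords, smul_ofCoords]
    norm_num
  have h66 : W2mul (φ (ofCoords 0 0 0 0 0 1)) (φ (ofCoords 0 0 0 0 0 1)) = 0 := by
    rw [← h.2, W2mul_ofCoords]
    simp [ofCoords_zero]
  have hne4 := h.map_ne_zero (x := ofCoords 0 0 0 1 0 0) (by simp [← ofCoords_zero, ofCoords_inj])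
  have hne6 := h.map_ne_zero (x := ofCoords 0 0 0 0 0 1) (by simp [← ofCoords_zero, ofCoords_inj])
  have hann := h.mul_map_eq_zero 0 1
  obtain ⟨n1, n2, q, p, n5, n6, hn⟩ := exists_eq_ofCoords (φ (ofCoords 0 0 0 1 0 0))
  obtain ⟨f1, f2, f3, f4, f5, f6, hf⟩ := exists_eq_ofCoords (φ (ofCoords 0 0 0 0 1 0))
  obtain ⟨g1, g2, g3, g4, g5, g6, hg⟩ := exists_eq_ofCoords (φ (ofCoords 0 0 0 0 0 1))
  rw [hn] at hann hne4
  rw [hg] at hne6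
  obtain ⟨rfl, rfl, rfl, rfl⟩ := mul_ofCoords_eq_zero_iff.1 hann
  simp only [hn, hf, hg, W2mul_ofCoords, smul_ofCoords, ← ofCoords_zero, ofCoords_inj]
    at h54 h64 h55 h56 h66
  by_cases hq : q = 0
  · subst hq
    refine ⟨p, ?_, hn⟩
    rintro rfl
    exact hne4 ofCoords_zero
  exfalso
  obtain ⟨-, -, h543, -, h545, -⟩ := h54
  obtain ⟨-, -, -, -, h645, h646⟩ := h64
  obtain rfl : f2 = 0 := mul_left_cancel₀ hq (by linear_combination -h545)
  obtain rfl : g2 = 0 := mul_left_cancel₀ hq (by linear_combination -h645)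
  obtain rfl : f5 = f1 := mul_left_cancel₀ hq (by linear_combination -h543)
  obtain rfl : g5 = g1 := mul_left_cancel₀ hq (by linear_combination -h646)
  have h3 : (3 : F) ≠ 0 := by norm_num
  obtain rfl : g5 = 0 := by
    refine pow_eq_zero_iff two_ne_zero |>.1 (mul_left_cancel₀ h3 ?_)
    linear_combination -h66.1
  obtain ⟨-, -, h563, h564, -, h566⟩ := h56
  obtain rfl : g3 = 0 := by linear_combination h563
  obtain rfl : g6 = 0 := by linear_combination h566
  obtain ⟨h551, -⟩ := h55
  have hf1 : f5 * (3 * f5 - 2) = 0 := by linear_combination -h551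
  have hg4 : g4 = 0 := by
    rcases mul_eq_zero.1 hf1 with hf1 | hf1
    · linear_combination h564 - 3 * g4 * hf1
    · exact mul_left_cancel₀ h3 (by linear_combination h564 - g4 * hf1)
  exact hne6 (by rw [hg4, ofCoords_zero])

theorem map_e5 [CharZero F] (h : IsAutomorphismW2 φ) :
    ∃ b, φ (ofCoords 0 0 0 0 1 0) = ofCoords 0 0 0 0 1 (-b) := by
  have h54 : W2mul (φ (ofCoords 0 0 0 0 1 0)) (φ (ofCoords 0 0 0 1 0 0)) = 0 := by
    rw [← h.2, W2mul_ofCoords]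
    simp [ofCoords_zero]
  have h55 : W2mul (φ (ofCoords 0 0 0 0 1 0)) (φ (ofCoords 0 0 0 0 1 0)) =
      (-2 : F) • φ (ofCoords 0 0 0 0 1 0) := by
    rw [← h.2, ← map_smul, W2mul_ofCoords, smul_ofCoords]
    norm_num
  have hne := h.map_ne_zero (x := ofCoords 0 0 0 0 1 0) (by simp [← ofCoords_zero, ofCoords_inj])
  obtain ⟨d, hd, hd4⟩ := h.map_e4
  obtain ⟨f1, f2, f3, f4, f5, f6, hf⟩ := exists_eq_ofCoords (φ (ofCoords 0 0 0 0 1 0))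
  rw [hf] at hne
  simp only [hf, hd4, W2mul_ofCoords, smul_ofCoords, ← ofCoords_zero, ofCoords_inj] at h54 h55
  obtain ⟨-, -, h543, h544, -, -⟩ := h54
  have h2 : (2 : F) ≠ 0 := by norm_num
  have h3 : (3 : F) ≠ 0 := by norm_num
  obtain rfl : f2 = 0 := mul_left_cancel₀ hd (by linear_combination h543)
  obtain rfl : f1 = 0 := mul_left_cancel₀ (mul_ne_zero h3 hd) (by linear_combination h544)
  obtain ⟨-, -, h553, h554, h555, h556⟩ := h55
  have h5 : f5 = 1 := by
    by_contra h5
    obtain rfl : f5 = 0 := by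
      refine mul_left_cancel₀ (mul_ne_zero h2 (sub_ne_zero.2 h5)) ?_
      linear_combination -h555
    obtain rfl : f3 = 0 := mul_left_cancel₀ h2 (by linear_combination h553)
    obtain rfl : f6 = 0 := mul_left_cancel₀ h2 (by linear_combination h556)
    obtain rfl : f4 = 0 := mul_left_cancel₀ h2 (by linear_combination h554)
    exact hne ofCoords_zero
  subst h5
  obtain rfl : f3 = 0 := by linear_combination h553
  obtain rfl : f4 = 0 := mul_left_cancel₀ h2 (by linear_combination h554)
  exact ⟨-f6, by rw [hf, neg_neg]⟩

/-- Every automorphism of `W2` is the transport of structure along a linear automorphism of `V₂`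
fixing `v₁`, with `c = a⁻¹`. -/
theorem exists_map_ofCoords [CharZero F] (h : IsAutomorphismW2 φ) :
    ∃ a b c : F, a * c = 1 ∧ ∀ x₁ x₂ x₃ x₄ x₅ x₆,
      φ (ofCoords x₁ x₂ x₃ x₄ x₅ x₆) = ofCoords (x₁ + a * b * x₂) (a * x₂)
        (2 * b * x₁ + a * b ^ 2 * x₂ + c * x₃)
        (3 * b ^ 2 * x₁ + a * b ^ 3 * x₂ + 3 * b * c * x₃ + c ^ 2 * x₄)
        x₅ (c * x₆ - b * x₅) := by
  have h52 : W2mul (φ (ofCoords 0 0 0 0 1 0)) (φ (ofCoords 0 1 0 0 0 0)) =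
      (-3 : F) • φ (ofCoords 0 1 0 0 0 0) := by
    rw [← h.2, ← map_smul, W2mul_ofCoords, smul_ofCoords]
    norm_num
  have h56 : W2mul (φ (ofCoords 0 0 0 0 1 0)) (φ (ofCoords 0 0 0 0 0 1)) =
      (-1 : F) • φ (ofCoords 0 0 0 0 0 1) := by
    rw [← h.2, ← map_smul, W2mul_ofCoords, smul_ofCoords]
    norm_num
  have h65 : W2mul (φ (ofCoords 0 0 0 0 0 1)) (φ (ofCoords 0 0 0 0 1 0)) =
      (-1 : F) • φ (ofCoords 0 0 0 0 0 1) := by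
    rw [← h.2, ← map_smul, W2mul_ofCoords, smul_ofCoords]
    norm_num
  have h26 : W2mul (φ (ofCoords 0 1 0 0 0 0)) (φ (ofCoords 0 0 0 0 0 1)) =
      (-1 : F) • φ (ofCoords 0 0 0 0 1 0) := by
    rw [← h.2, ← map_smul, W2mul_ofCoords, smul_ofCoords]
    norm_num
  have h24 : W2mul (φ (ofCoords 0 1 0 0 0 0)) (φ (ofCoords 0 0 0 1 0 0)) =
      φ (ofCoords 0 0 1 0 0 0) := by
    rw [← h.2, W2mul_ofCoords]
    norm_num
  have h62 : W2mul (φ (ofCoords 0 0 0 0 0 1)) (φ (ofCoords 0 1 0 0 0 0)) =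
      φ (ofCoords 1 0 0 0 0 0) := by
    rw [← h.2, W2mul_ofCoords]
    norm_num
  have h33 : W2mul (φ (ofCoords 0 0 1 0 0 0)) (φ (ofCoords 0 0 1 0 0 0)) =
      (-3 : F) • φ (ofCoords 0 0 0 1 0 0) := by
    rw [← h.2, ← map_smul, W2mul_ofCoords, smul_ofCoords]
    norm_num
  obtain ⟨d, hd, hd4⟩ := h.map_e4
  obtain ⟨b, hb⟩ := h.map_e5
  obtain ⟨m1, a, m3, m4, m5, m6, hm⟩ := exists_eq_ofCoords (φ (ofCoords 0 1 0 0 0 0))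
  obtain ⟨g1, g2, g3, g4, g5, c, hg⟩ := exists_eq_ofCoords (φ (ofCoords 0 0 0 0 0 1))
  have h2 : (2 : F) ≠ 0 := by norm_num
  have h3 : (3 : F) ≠ 0 := by norm_num
  rw [hm, hd4, W2mul_ofCoords] at h24
  rw [hg, hm, W2mul_ofCoords] at h62
  simp only [← h24, hm, hg, hb, hd4, W2mul_ofCoords, smul_ofCoords, ofCoords_inj]
    at h52 h56 h65 h26 h33
  obtain ⟨h521, -, h523, h524, h525, h526⟩ := h52
  obtain rfl : m5 = 0 := by linear_combination h525
  obtain rfl : m6 = 0 := mul_left_cancel₀ h2 (by linear_combination h526)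
  obtain rfl : m1 = a * b := by linear_combination h521
  obtain rfl : m3 = a * b ^ 2 := mul_left_cancel₀ h2 (by linear_combination h523)
  obtain rfl : m4 = a * b ^ 3 := mul_left_cancel₀ h3 (by linear_combination h524)
  obtain ⟨h561, h562, -, h564, h565, -⟩ := h56
  obtain rfl : g2 = 0 := mul_left_cancel₀ h2 (by linear_combination -h562)
  obtain rfl : g5 = 0 := by linear_combination -h565
  obtain rfl : g1 = 0 := by linear_combination -h561
  obtain ⟨-, -, -, -, -, h656⟩ := h65
  obtain rfl : g3 = 0 := by linear_combination h656
  obtain rfl : g4 = 0 := by linear_combination h564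
  obtain ⟨-, -, -, -, h265, -⟩ := h26
  have hac : a * c = 1 := by linear_combination -h265
  obtain ⟨-, -, -, h334, -, -⟩ := h33
  have had : a ^ 2 * d = 1 := mul_left_cancel₀ (mul_ne_zero h3 hd) (by linear_combination -h334)
  obtain rfl : d = c ^ 2 := by linear_combination c ^ 2 * had - (a * c + 1) * d * hac
  refine ⟨a, b, c, hac, fun x₁ x₂ x₃ x₄ x₅ x₆ => ?_⟩
  rw [map_ofCoords]
  simp only [hm, hg, hb, hd4, ← h24, ← h62, smul_ofCoords, ofCoords_add,
    ofCoords_inj]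
  refine ⟨?_, ?_, ?_, ?_, ?_, ?_⟩
  · linear_combination x₁ * hac
  · ring
  · linear_combination (2 * b * x₁ + c * x₃) * hac
  · linear_combination (3 * b ^ 2 * x₁ + 3 * b * c * x₃) * hac
  · ring
  · ring

end IsAutomorphismW2

/-- Every local automorphism of the algebra `W2` is an automorphism. -/
theorem every_localAutomorphism_isAutomorphism_W2 {F : Type*} [Field F] [CharZero F]
    (T : W2 F →ₗ[F] W2 F)
    (hT : ∀ x : W2 F, ∃ φ : W2 F →ₗ[F] W2 F, IsAutomorphismW2 φ ∧ T x = φ x) :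
    IsAutomorphismW2 T := by
  have key (x₁ x₂ x₃ x₄ x₅ x₆ : F) : ∃ a b c : F, a * c = 1 ∧
      T (ofCoords x₁ x₂ x₃ x₄ x₅ x₆) = ofCoords (x₁ + a * b * x₂) (a * x₂)
        (2 * b * x₁ + a * b ^ 2 * x₂ + c * x₃)
        (3 * b ^ 2 * x₁ + a * b ^ 3 * x₂ + 3 * b * c * x₃ + c ^ 2 * x₄)
        x₅ (c * x₆ - b * x₅) := by
    obtain ⟨φ, hφ, hx⟩ := hT (ofCoords x₁ x₂ x₃ x₄ x₅ x₆)
    obtain ⟨a, b, c, hac, hmap⟩ := hφ.exists_map_ofCoords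
    exact ⟨a, b, c, hac, hx.trans (hmap ..)⟩
  -- `φ` agrees with `T` at `e₂ + e₅`, and this forces agreement on the whole basis.
  obtain ⟨φ, hφ, h25⟩ := hT (ofCoords 0 1 0 0 1 0)
  obtain ⟨a, b, c, hac, hmap⟩ := hφ.exists_map_ofCoords
  obtain ⟨a1, b1, c1, hac1, h1⟩ := key 1 0 0 0 0 0
  obtain ⟨a2, b2, c2, hac2, h2'⟩ := key 0 1 0 0 0 0
  obtain ⟨a3, b3, c3, hac3, h3'⟩ := key 0 0 1 0 0 0
  obtain ⟨a4, b4, c4, hac4, h4⟩ := key 0 0 0 1 0 0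
  obtain ⟨a5, b5, c5, hac5, h5⟩ := key 0 0 0 0 1 0
  obtain ⟨a6, b6, c6, hac6, h6⟩ := key 0 0 0 0 0 1
  obtain ⟨a15, b15, c15, hac15, h15⟩ := key 1 0 0 0 1 0
  obtain ⟨a35, b35, c35, hac35, h35⟩ := key 0 0 1 0 1 0
  obtain ⟨a26, b26, c26, hac26, h26⟩ := key 0 1 0 0 0 1
  obtain ⟨a36, b36, c36, hac36, h36⟩ := key 0 0 1 0 0 1
  obtain ⟨a46, b46, c46, hac46, h46⟩ := key 0 0 0 1 0 1
  have h2 : (2 : F) ≠ 0 := by norm_num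
  have h3 : (3 : F) ≠ 0 := by norm_num
  have ha : a ≠ 0 := left_ne_zero_of_mul_eq_one hac
  have hc : c ≠ 0 := right_ne_zero_of_mul_eq_one hac
  rw [hmap] at h25
  rw [map_ofCoords] at h25 h15 h35 h26 h36 h46
  simp only [h1, h2', h3', h4, h5, h6, smul_ofCoords, ofCoords_add,
    ofCoords_inj] at h25 h15 h35 h26 h36 h46
  obtain ⟨h251, h252, -, -, -, h256⟩ := h25
  obtain ⟨-, -, h153, -, -, h156⟩ := h15
  obtain ⟨-, -, h353, h354, -, h356⟩ := h35
  obtain ⟨-, h262, -, -, -, h266⟩ := h26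
  obtain ⟨-, -, h363, -, -, h366⟩ := h36
  obtain ⟨-, -, -, h464, -, h466⟩ := h46
  obtain rfl : a2 = a := by linear_combination h252
  obtain rfl : b5 = b := by linear_combination -h256
  obtain rfl : b2 = b5 := mul_left_cancel₀ ha (by linear_combination h251)
  obtain rfl : b1 = b2 := mul_left_cancel₀ h2 (by linear_combination h153 + 2 * h156)
  obtain rfl : a26 = a2 := by linear_combination -h262
  obtain rfl : c26 = c := mul_left_cancel₀ ha (by linear_combination hac26 - hac)
  obtain rfl : c6 = c26 := by linear_combination h266
  obtain rfl : c3 = c6 := by linear_combination h363 - h366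
  obtain rfl : b3 = b1 := by
    refine mul_left_cancel₀ (mul_ne_zero h3 hc) ?_
    linear_combination h354 + 3 * c3 * h356 - 3 * b35 * h353
  have hc4 : c4 ^ 2 = c3 ^ 2 := by linear_combination h464 - (c46 + c3) * h466
  have hTφ : T = φ := by
    ext1 x
    obtain ⟨x₁, x₂, x₃, x₄, x₅, x₆, rfl⟩ := exists_eq_ofCoords x
    rw [map_ofCoords T, map_ofCoords φ]
    simp only [h1, h2', h3', h4, h5, h6, hmap, hc4]
    simp
  exact hTφ ▸ hφ
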